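/- Let P be a PDA such that in every run of P the stack height never exceeds k. Then P is at most k-oscillating: every run r of P satisfies osc(r) ≤ k. -/

import Mathlib

/-- The two-letter Dyck alphabet: `D.ab` is `ā` (the opening symbol) and `D.a` is `a`
(the closing symbol). -/
inductive D where
  | ab : D  -- ā
  | a : D   -- a
deriving DecidableEq

/-- Parse trees of the grammar `G_D = ({S}, {ā, a}, S, {S → ā S a S, S → ε})`:
`eps` is an application of `S → ε` and `node t₁ t₂` an application of `S → ā S a S`. -/
inductive DyckTree where
  | eps : DyckTree
  | node : DyckTree → DyckTree → DyckTree

/-- The word generated by a parse tree of `G_D`. -/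
def DyckTree.yield : DyckTree → List D
  | .eps => []
  | .node t₁ t₂ => D.ab :: (t₁.yield ++ D.a :: t₂.yield)

/-- The Dyck language `L_D`: the language generated by `G_D`. -/
def LD : Set (List D) := { w | ∃ t : DyckTree, t.yield = w }

/-- `Matches t i j` holds iff positions `i < j` (0-indexed) of the word `t.yield` form a
matching pair: position `i` carries `ā`, position `j` carries `a`, and the two
corresponding leaves have the same parent in the parse tree `t`. -/
inductive Matches : DyckTree → ℕ → ℕ → Prop
  | head (t₁ t₂ : DyckTree) : Matches (.node t₁ t₂) 0 (t₁.yield.length + 1)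
  | left {t₁ : DyckTree} {i j : ℕ} (t₂ : DyckTree) :
      Matches t₁ i j → Matches (.node t₁ t₂) (i + 1) (j + 1)
  | right {t₂ : DyckTree} {i j : ℕ} (t₁ : DyckTree) :
      Matches t₂ i j → Matches (.node t₁ t₂) (t₁.yield.length + 2 + i) (t₁.yield.length + 2 + j)

/-- `DelStep w v`: `v` results from `w ∈ L_D` by deleting (both positions of) one
matching pair of `w`. -/
def DelStep (w v : List D) : Prop :=
  ∃ (t : DyckTree) (i j : ℕ), t.yield = w ∧ Matches t i j ∧
    v = (w.eraseIdx j).eraseIdx i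

/-- The ordering `≼` on Dyck words: `dyckLE v w` (i.e. `v ≼ w`) holds iff `v` results
from `w` by deleting 0 or more matching pairs. -/
def dyckLE (v w : List D) : Prop := Relation.ReflTransGen DelStep w v

/-- The harmonics: `h_0 = ε` and `h_{i+1} = ā h_i a ā h_i a`. -/
def harmonicW : ℕ → List D
  | 0 => []
  | i + 1 => (D.ab :: (harmonicW i ++ [D.a])) ++ (D.ab :: (harmonicW i ++ [D.a]))

/-- `ĥ_i = ā h_i a`. -/
def hatHarmonic (i : ℕ) : List D := D.ab :: (harmonicW i ++ [D.a])

/-- The rank of a Dyck word `w`: the greatest `q` such that `h_q ≼ w`. -/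
noncomputable def rank (w : List D) : ℕ := sSup { q : ℕ | dyckLE (harmonicW q) w }

/-- A pushdown automaton with states `Q`, input alphabet `σ` and stack alphabet `Γ`
(the types `Q`, `σ`, `Γ` are meant to be finite, which is required where relevant):
`δ` is the set of actions, an action `(q, b, γ, p, ξ)` standing for
`(q, b, γ) ↪ (p, ξ)` with `b ∈ Σ ∪ {ε}` encoded by `Option σ`; `q0` is the start state
and `γ0` the start stack symbol. Acceptance is by empty stack. -/
structure PDA (Q σ Γ : Type) where
  δ : Set (Q × Option σ × Γ × Q × List Γ)
  q0 : Q
  γ0 : Γ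

/-- An instantaneous descriptor: state, remaining input, stack content. -/
structure ID (Q σ Γ : Type) where
  state : Q
  tape : List σ
  stack : List Γ

/-- The move relation: an action `(q, b, γ) ↪ (p, ξ′)` induces the move
`(q, b w, γ ξ) ⊢ (p, w, ξ′ ξ)`. -/
def PDA.Move {Q σ Γ : Type} (P : PDA Q σ Γ) (I I' : ID Q σ Γ) : Prop :=
  ∃ (b : Option σ) (γ : Γ) (ξ rest : List Γ),
    (I.state, b, γ, I'.state, ξ) ∈ P.δ ∧
    I.stack = γ :: rest ∧ I'.stack = ξ ++ rest ∧
    I.tape = b.toList ++ I'.tape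

/-- A quasi-run: a move sequence `I₀ ⊢ I₁ ⊢ … ⊢ I_m` such that the stack of `I₀` is a
single symbol and the stack of `I_m` is empty (represented as the list `[I₀, …, I_m]`). -/
def PDA.IsQuasiRun {Q σ Γ : Type} (P : PDA Q σ Γ) (r : List (ID Q σ Γ)) : Prop :=
  r.Chain' P.Move ∧
  (∃ (I : ID Q σ Γ) (γ : Γ), r.head? = some I ∧ I.stack = [γ]) ∧
  (∃ I' : ID Q σ Γ, r.getLast? = some I' ∧ I'.stack = [])

/-- A run on input `w`: a quasi-run whose first ID is the initial ID `(q₀, w, γ₀)` and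
whose last ID has empty tape (and, being a quasi-run, empty stack). -/
def PDA.IsRun {Q σ Γ : Type} (P : PDA Q σ Γ) (w : List σ) (r : List (ID Q σ Γ)) : Prop :=
  P.IsQuasiRun r ∧ r.head? = some ⟨P.q0, w, [P.γ0]⟩ ∧
  (∃ I' : ID Q σ Γ, r.getLast? = some I' ∧ I'.tape = [])

/-- The language of `P` (acceptance by empty stack). -/
def PDA.lang {Q σ Γ : Type} (P : PDA Q σ Γ) : Set (List σ) := { w | ∃ r, P.IsRun w r }

/-- The footprint `α′(r)` of a quasi-run `r = I₀, …, I_m`, defined in the paper by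
disassembly: `α′(r) = a` if `m = 1`, and `α′(r) = a ā^d α′(r₁) … α′(r_d)` if `m > 1`,
where `d = |stack(I₁)|` and `r₁, …, r_d` is the disassembly of `r`.  Equivalently
(unfolding the disassembly), each move `I ⊢ I'` contributes `a` (for the popped
symbol) followed by `ā^{|ξ|}` where `|ξ| = |stack(I')| + 1 − |stack(I)|` is the number
of pushed symbols; this computation is used here. -/
def alphaQR' {Q σ Γ : Type} : List (ID Q σ Γ) → List D
  | I :: I' :: rest =>
      (D.a :: List.replicate (I'.stack.length + 1 - I.stack.length) D.ab) ++
        alphaQR' (I' :: rest)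
  | _ => []

/-- The footprint `α(r) = ā α′(r)` of a quasi-run `r`. -/
def alphaQR {Q σ Γ : Type} (r : List (ID Q σ Γ)) : List D := D.ab :: alphaQR' r

/-- The oscillation of a quasi-run: `osc(r) = rank(α(r))`. -/
noncomputable def oscQR {Q σ Γ : Type} (r : List (ID Q σ Γ)) : ℕ := rank (alphaQR r)

/-- `L^(k)(P)`: the set of words accepted by some `k`-oscillating run of `P`. -/
noncomputable def PDA.oscLang {Q σ Γ : Type} (P : PDA Q σ Γ) (k : ℕ) : Set (List σ) :=
  { w | ∃ r, P.IsRun w r ∧ oscQR r = k }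

/-- A PDA is in reduced form if it has a single state (`Q = PUnit`) and each action
pops a symbol (`ξ = ε`) or pushes two symbols (`ξ ∈ Γ²`). -/
def PDA.Reduced {σ Γ : Type} (P : PDA PUnit σ Γ) : Prop :=
  ∀ a ∈ P.δ, (a.2.2.2.2 : List Γ).length = 2 ∨ a.2.2.2.2 = []

/-- For IDs `I, I'` with `stack(I) = ξ stack(I')`, `I/I' = (state(I), tape(I), ξ)`. -/
def quotID {Q σ Γ : Type} (I I' : ID Q σ Γ) : ID Q σ Γ :=
  ⟨I.state, I.tape, I.stack.take (I.stack.length - I'.stack.length)⟩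

instance {σ Γ : Type} : Inhabited (ID PUnit σ Γ) := ⟨⟨PUnit.unit, [], []⟩⟩

/-- The segment `I_s/I_e, I_{s+1}/I_e, …, I_e/I_e` of a quasi-run `r = I₀, …, I_m`,
for positions `s ≤ e`. -/
def segmentQR {σ Γ : Type} (r : List (ID PUnit σ Γ)) (s e : ℕ) : List (ID PUnit σ Γ) :=
  (List.range (e - s + 1)).map (fun j => quotID (r.getD (s + j) default) (r.getD e default))

/-!
STATEMENT 16: Let `P` be a PDA such that in every run of `P` the stack height never
exceeds `k`. Then `P` is at most `k`-oscillating: every run `r` of `P` satisfies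
`osc(r) ≤ k`.
-/

/-- The number of opening symbols minus the number of closing symbols of a word. -/
def balance : List D → ℤ
  | [] => 0
  | .ab :: w => 1 + balance w
  | .a :: w => -1 + balance w

/-- The greatest balance of a prefix of a word. -/
def maxHeight : List D → ℤ
  | [] => 0
  | .ab :: w => max 0 (1 + maxHeight w)
  | .a :: w => max 0 (-1 + maxHeight w)

lemma maxHeight_nonneg (w : List D) : 0 ≤ maxHeight w := by
  rcases w with _ | ⟨_ | _, w⟩ <;> simp [maxHeight]

lemma maxHeight_append (u v : List D) :
    maxHeight (u ++ v) = max (maxHeight u) (balance u + maxHeight v) := by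
  induction u with
  | nil => simp [maxHeight, balance, maxHeight_nonneg]
  | cons c u ih => cases c <;> simp only [List.cons_append, maxHeight, balance, ih] <;> omega

lemma maxHeight_replicate_append (d : ℕ) (w : List D) :
    maxHeight (List.replicate d D.ab ++ w) = d + maxHeight w := by
  induction d with
  | zero => simp
  | succ d ih =>
    have := maxHeight_nonneg w
    simp only [List.replicate_succ, List.cons_append, maxHeight, ih]
    push_cast
    omega

lemma Matches.exists_yield_eq {t : DyckTree} {i j : ℕ} (h : Matches t i j) :
    ∃ u x v : List D, t.yield = u ++ D.ab :: (x ++ D.a :: v) ∧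
      i = u.length ∧ j = u.length + 1 + x.length := by
  induction h with
  | head t₁ t₂ => exact ⟨[], t₁.yield, t₂.yield, rfl, rfl, by simp [Nat.add_comm]⟩
  | left t₂ _ ih =>
    obtain ⟨u, x, v, hy, rfl, rfl⟩ := ih
    exact ⟨D.ab :: u, x, v ++ D.a :: t₂.yield, by simp [DyckTree.yield, hy], by simp,
      by simp; omega⟩
  | right t₁ _ ih =>
    obtain ⟨u, x, v, hy, rfl, rfl⟩ := ih
    exact ⟨D.ab :: (t₁.yield ++ D.a :: u), x, v, by simp [DyckTree.yield, hy],
      by simp; omega, by simp; omega⟩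

lemma DelStep.maxHeight_le {w v : List D} (h : DelStep w v) : maxHeight v ≤ maxHeight w := by
  obtain ⟨t, i, j, rfl, hm, rfl⟩ := h
  obtain ⟨u, x, v, hy, rfl, rfl⟩ := hm.exists_yield_eq
  have herase : ((u ++ D.ab :: (x ++ D.a :: v)).eraseIdx (u.length + 1 + x.length)).eraseIdx
      u.length = u ++ (x ++ v) := by
    rw [List.eraseIdx_append_of_length_le (by omega),
      show u.length + 1 + x.length - u.length = x.length + 1 by omega, List.eraseIdx_cons_succ,
      List.eraseIdx_append_of_length_le le_rfl, List.eraseIdx_append_of_length_le le_rfl]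
    simp
  rw [hy, herase]
  simp only [maxHeight_append, maxHeight]
  omega

lemma dyckLE.maxHeight_le {v w : List D} (h : dyckLE v w) : maxHeight v ≤ maxHeight w := by
  induction h with
  | refl => exact le_rfl
  | tail _ hs ih => exact hs.maxHeight_le.trans ih

lemma le_maxHeight_harmonicW (q : ℕ) : (q : ℤ) ≤ maxHeight (harmonicW q) := by
  induction q with
  | zero => simp [harmonicW, maxHeight]
  | succ q ih =>
    simp only [harmonicW, maxHeight_append, maxHeight]
    push_cast
    omega

lemma rank_le_of_maxHeight_le {w : List D} {k : ℕ} (h : maxHeight w ≤ k) : rank w ≤ k :=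
  csSup_le' fun q hq => by
    have := (le_maxHeight_harmonicW q).trans ((dyckLE.maxHeight_le hq).trans h)
    exact_mod_cast this

lemma PDA.Move.length_stack_le {Q σ Γ : Type} {P : PDA Q σ Γ} {I I' : ID Q σ Γ}
    (h : P.Move I I') : 1 ≤ I.stack.length ∧ I.stack.length ≤ I'.stack.length + 1 := by
  obtain ⟨b, γ, ξ, rest, -, h₁, h₂, -⟩ := h
  rw [h₁, h₂]
  simp only [List.length_cons, List.length_append]
  omega

lemma length_stack_add_maxHeight_alphaQR'_le {Q σ Γ : Type} {P : PDA Q σ Γ} {k : ℕ}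
    (r : List (ID Q σ Γ)) (I : ID Q σ Γ) (hr : (I :: r).IsChain P.Move)
    (hk : ∀ J ∈ I :: r, J.stack.length ≤ k) :
    I.stack.length + maxHeight (alphaQR' (I :: r)) ≤ k := by
  induction r generalizing I with
  | nil => simpa [alphaQR', maxHeight] using hk
  | cons I' r ih =>
    rw [List.isChain_cons_cons] at hr
    have hI := hk I List.mem_cons_self
    have hI' := ih I' hr.2 fun J hJ => hk J (List.mem_cons_of_mem _ hJ)
    have hmove := hr.1.length_stack_le
    simp only [alphaQR', List.cons_append, maxHeight, maxHeight_replicate_append]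
    omega

theorem osc_le_of_bounded_height {Q σ Γ : Type} [Finite Q] [Finite σ] [Finite Γ]
    (P : PDA Q σ Γ) (k : ℕ)
    (hheight : ∀ (w : List σ) (r : List (ID Q σ Γ)), P.IsRun w r →
      ∀ I ∈ r, I.stack.length ≤ k) :
    ∀ (w : List σ) (r : List (ID Q σ Γ)), P.IsRun w r → oscQR r ≤ k := by
  rintro w r hr
  have hk := hheight w r hr
  obtain ⟨⟨hchain, -, -⟩, hhead, -⟩ := hr
  obtain ⟨r, rfl⟩ : ∃ r', r = ⟨P.q0, w, [P.γ0]⟩ :: r' := by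
    cases r with
    | nil => simp at hhead
    | cons I r => exact ⟨r, by simpa using hhead⟩
  have h := length_stack_add_maxHeight_alphaQR'_le r _ hchain hk
  refine rank_le_of_maxHeight_le ?_
  simp only [List.length_singleton, Nat.cast_one] at h
  simp only [alphaQR, maxHeight]
  omega
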